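/- For every natural number ν, the tree T(ν) of ordinal interaction sequences of depth at most ν, ordered by ⪯, is well-founded: there is no infinite sequence u₀ ≺ u₁ ≺ u₂ ≺ ⋯ of ordinal interaction sequences of depth at most ν. -/

import Mathlib

set_option linter.deprecated false

/-- `Vset i n` is the set `V(n)` associated to a pointer sequence `i`:
`V(0) = ∅`, `V(n+1) = {n} ∪ V(i n)`.  (The `min` is a harmless truncation making the
recursion well-founded; for a pointer sequence `i n ≤ n`, so `min (i n) n = i n`.) -/
def Vset (i : ℕ → ℕ) : ℕ → Finset ℕ
  | 0 => ∅
  | n + 1 => insert n (Vset i (min (i n) n))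
  decreasing_by exact Nat.lt_succ_of_le (min_le_right _ _)

/-- An (infinite) pointer sequence: `i 0 = 0` and `i (n+1) < n+1`. -/
def IsPointerSeq (i : ℕ → ℕ) : Prop := i 0 = 0 ∧ ∀ n, i (n + 1) < n + 1

/-- An (infinite) interaction sequence: a pointer sequence with `i (n+1) ∈ V(n+1)`. -/
def IsInteractionSeq (i : ℕ → ℕ) : Prop :=
  IsPointerSeq i ∧ ∀ n, i (n + 1) ∈ Vset i (n + 1)

/-- `W(0) = ∅`, `W(n+1) = {n, i n} ∪ W(i n)`. -/
def Wset (i : ℕ → ℕ) : ℕ → Finset ℕ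
  | 0 => ∅
  | n + 1 => insert n (insert (i n) (Wset i (min (i n) n)))
  decreasing_by exact Nat.lt_succ_of_le (min_le_right _ _)

/-- Length of the pointer chain `n, i n, i (i n), …, 0` (stopping at `0`). -/
def chainLen (i : ℕ → ℕ) : ℕ → ℕ
  | 0 => 1
  | n + 1 => chainLen i (min (i (n + 1)) n) + 1
  decreasing_by exact Nat.lt_succ_of_le (min_le_right _ _)

/-- The interaction sequence `i` has depth at most `ν`: every pointer chain has length `≤ ν+1`. -/
def DepthAtMost (i : ℕ → ℕ) (ν : ℕ) : Prop := ∀ n, chainLen i n ≤ ν + 1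

/-- `I` is isolated for `i`: `i n ∈ I → n ∈ I`. -/
def Isolated (i : ℕ → ℕ) (I : Set ℕ) : Prop := ∀ n, i n ∈ I → n ∈ I

/-- Finite versions: conditions imposed only on indices `< n`. -/
def IsPointerSeqUpTo (n : ℕ) (i : ℕ → ℕ) : Prop :=
  (0 < n → i 0 = 0) ∧ ∀ m, m + 1 < n → i (m + 1) < m + 1

def IsInteractionSeqUpTo (n : ℕ) (i : ℕ → ℕ) : Prop :=
  IsPointerSeqUpTo n i ∧ ∀ m, m + 1 < n → i (m + 1) ∈ Vset i (m + 1)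

def IsolatedUpTo (n : ℕ) (i : ℕ → ℕ) (I : Set ℕ) : Prop :=
  ∀ m, m < n → i m ∈ I → m ∈ I

def DepthAtMostUpTo (n : ℕ) (i : ℕ → ℕ) (ν : ℕ) : Prop :=
  ∀ m, m < n → chainLen i m ≤ ν + 1

/-- An ordinal interaction sequence `(α₀,i₀)⋯(α_{n-1},i_{n-1}) αₙ`:
`pairs` lists `(α_k, i_k)` for `k < n`, and `last` is `αₙ`. -/
structure OIS where
  pairs : List (Ordinal.{0} × ℕ)
  last : Ordinal.{0}

namespace OIS

/-- The pointer `i_k` (junk for `k ≥ n`). -/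
def ptrAt (u : OIS) (k : ℕ) : ℕ := (u.pairs.getD k (0, 0)).2

/-- The ordinal `α_k`, for `k ≤ n` (`α_n` is `u.last`). -/
def ordAt (u : OIS) (k : ℕ) : Ordinal :=
  if k < u.pairs.length then (u.pairs.getD k (0, 0)).1 else u.last

/-- `u` is a genuine ordinal interaction sequence: the pointers form an interaction
sequence, and `α_{m+1} < α_{i_m}` for all `0 < m < n`. -/
def valid (u : OIS) : Prop :=
  IsInteractionSeqUpTo u.pairs.length u.ptrAt ∧
  ∀ m, 0 < m → m + 1 ≤ u.pairs.length → u.ordAt (m + 1) < u.ordAt (u.ptrAt m)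

/-- All ordinals of `u` are `< α`. -/
def below (u : OIS) (α : Ordinal) : Prop := ∀ k, k ≤ u.pairs.length → u.ordAt k < α

/-- `u` has depth at most `ν`. -/
def depthLE (u : OIS) (ν : ℕ) : Prop := DepthAtMostUpTo u.pairs.length u.ptrAt ν

/-- `u ⪯ v`. -/
def le (u v : OIS) : Prop :=
  u.pairs.length ≤ v.pairs.length ∧
  (∀ k, k < u.pairs.length → u.pairs.getD k (0, 0) = v.pairs.getD k (0, 0)) ∧
  v.ordAt u.pairs.length ≤ u.last

/-- `u ≺ v`. -/
def prec (u v : OIS) : Prop := u.le v ∧ u ≠ v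

/-- The prefix `(α₀,i₀)⋯(α_{m-1},i_{m-1}) α_m` of `u`, for `m ≤ n`. -/
def prefixAt (u : OIS) (m : ℕ) : OIS := ⟨u.pairs.take m, u.ordAt m⟩

end OIS

/-- Membership in the tree `T(ν, α)` of ordinal interaction sequences of depth at
most `ν` below `α`, rooted at the empty sequence (`none`). -/
def InTree (ν : ℕ) (α : Ordinal.{0}) : Option OIS → Prop
  | none => True
  | some u => u.valid ∧ u.depthLE ν ∧ u.below α

/-- `≺` extended to the root: the empty sequence strictly precedes everything. -/
def OptPrec : Option OIS → Option OIS → Prop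
  | none, some _ => True
  | some u, some v => u.prec v
  | _, _ => False

/-- The "descends in the tree `T(ν,α)`" relation (for computing heights/ranks). -/
def treeRel (ν : ℕ) (α : Ordinal.{0}) (x y : Option OIS) : Prop :=
  OptPrec y x ∧ InTree ν α x ∧ InTree ν α y

/-- `c_0(α) = α·2`, `c_{ν+1}(α) = 3 ^ c_ν(α)`. -/
noncomputable def cfun : ℕ → Ordinal.{0} → Ordinal.{0}
  | 0, α => α * 2
  | ν + 1, α => 3 ^ cfun ν α

theorem Vset_succ {i : ℕ → ℕ} {n : ℕ} (h : i n ≤ n) :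
    Vset i (n + 1) = insert n (Vset i (i n)) := by
  rw [Vset, min_eq_left h]

theorem chainLen_succ {i : ℕ → ℕ} {n : ℕ} (h : i (n + 1) ≤ n) :
    chainLen i (n + 1) = chainLen i (i (n + 1)) + 1 := by
  rw [chainLen, min_eq_left h]

theorem Vset_congr {i j : ℕ → ℕ} (n : ℕ) (h : ∀ k < n, i k = j k) : Vset i n = Vset j n := by
  induction n using Nat.strong_induction_on with
  | _ n ih =>
    cases n with
    | zero => rw [Vset, Vset]
    | succ n =>
      rw [Vset, Vset, h n n.lt_succ_self, ih _ (Nat.lt_succ_of_le (min_le_right _ _))]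
      exact fun k hk => h k (hk.trans (Nat.lt_succ_of_le (min_le_right _ _)))

theorem chainLen_congr {i j : ℕ → ℕ} (n : ℕ) (h : ∀ k ≤ n, i k = j k) :
    chainLen i n = chainLen j n := by
  induction n using Nat.strong_induction_on with
  | _ n ih =>
    cases n with
    | zero => rw [chainLen, chainLen]
    | succ n =>
      rw [chainLen, chainLen, h (n + 1) le_rfl, ih _ (Nat.lt_succ_of_le (min_le_right _ _))]
      exact fun k hk => h k (hk.trans ((min_le_right _ _).trans n.le_succ))

theorem IsPointerSeq.le {i : ℕ → ℕ} (h : IsPointerSeq i) (n : ℕ) : i n ≤ n := by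
  cases n with
  | zero => exact h.1.le
  | succ n => exact (h.2 n).le

theorem IsPointerSeq.chainLen_eq {i : ℕ → ℕ} (h : IsPointerSeq i) {n : ℕ} (hn : 0 < n) :
    chainLen i n = chainLen i (i n) + 1 := by
  obtain ⟨n, rfl⟩ := Nat.exists_eq_succ_of_ne_zero hn.ne'
  exact chainLen_succ (Nat.lt_succ_iff.1 (h.2 n))

theorem IsInteractionSeq.mem_Vset {i : ℕ → ℕ} (h : IsInteractionSeq i) {n : ℕ} (hn : 0 < n) :
    i n ∈ Vset i n := by
  obtain ⟨n, rfl⟩ := Nat.exists_eq_succ_of_ne_zero hn.ne'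
  exact h.2 n

/-- `TopJump i ν x y`: the position `y` comes right after a move of chain length `ν + 1`
that points to `x`. -/
def TopJump (i : ℕ → ℕ) (ν x y : ℕ) : Prop :=
  ∃ m, 0 < m ∧ i m = x ∧ y = m + 1 ∧ chainLen i m = ν + 1

/-- Following top jumps decreases the ordinals, so it ends at a position
from which no top jump starts. -/
theorem exists_topJump_end {i : ℕ → ℕ} {ν : ℕ} {a : ℕ → Ordinal.{0}}
    (ha : ∀ m, 0 < m → a (m + 1) < a (i m)) (x : ℕ) :
    ∃ y, Relation.ReflTransGen (TopJump i ν) x y ∧ ∀ z, ¬ TopJump i ν y z := by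
  have hwf : WellFounded fun y x : ℕ => a y < a x := InvImage.wf a wellFounded_lt
  induction x using hwf.induction with
  | _ x ih =>
    by_cases hx : ∃ z, TopJump i ν x z
    · obtain ⟨z, hz⟩ := hx
      obtain ⟨m, hm, rfl, rfl, _⟩ := id hz
      obtain ⟨y, hy, hy'⟩ := ih _ (ha m hm)
      exact ⟨y, .head hz hy, hy'⟩
    · exact ⟨x, .refl, not_exists.1 hx⟩

theorem topJump_path {i : ℕ → ℕ} (hi : IsPointerSeq i) {ν : ℕ} {a : ℕ → Ordinal.{0}}
    (ha : ∀ m, 0 < m → a (m + 1) < a (i m)) {x y : ℕ}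
    (h : Relation.ReflTransGen (TopJump i ν) x y) :
    x ≤ y ∧ a y ≤ a x ∧ ∀ t ∈ Vset i y, chainLen i t = ν + 1 ∨ t ∈ Vset i x := by
  induction h with
  | refl => exact ⟨le_rfl, le_rfl, fun t ht => .inr ht⟩
  | tail _ hyz ih =>
    obtain ⟨m, hm, rfl, rfl, hc⟩ := hyz
    refine ⟨ih.1.trans ((hi.le m).trans m.le_succ), (ha m hm).le.trans ih.2.1, fun t ht => ?_⟩
    rw [Vset_succ (hi.le m), Finset.mem_insert] at ht
    rcases ht with rfl | ht
    · exact .inl hc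
    · exact ih.2.2 t ht

/-- An infinite interaction sequence of bounded depth admits no ordinal labelling.  The proof
is by induction on the depth: all segments from `i m` to `m`, with `m` of maximal depth, are
removed. -/
theorem IsInteractionSeq.no_labelling (ν : ℕ) {i : ℕ → ℕ} (hi : IsInteractionSeq i)
    (hd : DepthAtMost i ν) (a : ℕ → Ordinal.{0}) (ha : ∀ m, 0 < m → a (m + 1) < a (i m)) :
    False := by
  induction ν generalizing i a with
  | zero =>
    have h := hd 1
    rw [hi.1.chainLen_eq one_pos] at h
    have : 0 < chainLen i (i 1) := by cases i 1 <;> rw [chainLen] <;> omega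
    omega
  | succ ν ih =>
    have h0 : chainLen i 0 = 1 := by rw [chainLen]
    have i1 : i 1 = 0 := Nat.lt_one_iff.1 (hi.1.2 0)
    have i2 : i 2 = 1 := by
      have := hi.2 1
      rw [Vset_succ (hi.1.le 1), i1, Vset] at this
      simpa using this
    have hν : 1 ≤ ν := by
      have h := hd 2
      rw [hi.1.chainLen_eq two_pos, i2, hi.1.chainLen_eq one_pos, i1, h0] at h
      omega
    choose g hg hg' using exists_topJump_end (i := i) (ν := ν + 1) ha
    let e : ℕ → ℕ := fun n => Nat.rec 0 (fun _ x => g (x + 1)) n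
    have e0 : e 0 = 0 := rfl
    have es (n : ℕ) : e (n + 1) = g (e n + 1) := rfl
    have hpath (n : ℕ) := topJump_path hi.1 ha (hg (e n + 1))
    simp only [← es] at hpath
    have emono : StrictMono e := strictMono_nat_of_lt_succ fun n => (hpath n).1
    have epos {n : ℕ} (hn : 0 < n) : 0 < e n := emono hn
    have eend (n z : ℕ) : ¬ TopJump i (ν + 1) (e n) z := by
      cases n with
      | zero =>
        rintro ⟨m, hm, hm0, -, hc⟩
        rw [hi.1.chainLen_eq hm, hm0, e0, h0] at hc
        omega
      | succ n => exact hg' _ z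
    let j : ℕ → ℕ := fun n => Function.invFun e (i (e n))
    have j_eq {n t : ℕ} (h : e t = i (e n)) : j n = t := by
      change Function.invFun e (i (e n)) = t
      rw [← h, Function.leftInverse_invFun emono.injective]
    have j0 : j 0 = 0 := j_eq (by rw [e0, hi.1.1])
    have key {n : ℕ} (hn : 0 < n)
        (h : ∀ t ∈ Vset i (e n), chainLen i t = ν + 1 + 1 ∨ ∃ s ∈ Vset j n, e s = t) :
        j n ∈ Vset j n ∧ e (j n) = i (e n) := by
      rcases h _ (hi.mem_Vset (epos hn)) with hc | ⟨s, hs, hse⟩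
      · have := hd (e n)
        rw [hi.1.chainLen_eq (epos hn)] at this
        omega
      · rw [j_eq hse]
        exact ⟨hs, hse⟩
    have hV (n : ℕ) :
        ∀ t ∈ Vset i (e n), chainLen i t = ν + 1 + 1 ∨ ∃ s ∈ Vset j n, e s = t := by
      induction n using Nat.strong_induction_on with
      | _ n ihn =>
        cases n with
        | zero => intro t ht; rw [e0, Vset] at ht; simp at ht
        | succ n =>
          have hj : e (j n) = i (e n) := by
            rcases n.eq_zero_or_pos with rfl | hn
            · rw [j0, e0, hi.1.1]
            · exact (key hn (ihn n n.lt_succ_self)).2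
          have hjn : j n ≤ n := emono.le_iff_le.1 (hj.trans_le (hi.1.le _))
          intro t ht
          rw [Vset_succ hjn]
          rcases (hpath n).2.2 t ht with h | h
          · exact .inl h
          · rw [Vset_succ (hi.1.le _), Finset.mem_insert, ← hj] at h
            rcases h with rfl | h
            · exact .inr ⟨n, Finset.mem_insert_self _ _, rfl⟩
            · rcases ihn _ (Nat.lt_succ_of_le hjn) t h with h | ⟨s, hs, rfl⟩
              · exact .inl h
              · exact .inr ⟨s, Finset.mem_insert_of_mem hs, rfl⟩
    have hj {n : ℕ} (hn : 0 < n) := key hn (hV n)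
    have hjlt (n : ℕ) : j (n + 1) < n + 1 := by
      rw [← emono.lt_iff_lt, (hj n.succ_pos).2]
      obtain ⟨k, hk⟩ := Nat.exists_eq_succ_of_ne_zero (epos n.succ_pos).ne'
      rw [hk]
      exact hi.1.2 k
    have hjp : IsPointerSeq j := ⟨j0, hjlt⟩
    have hchain (n : ℕ) : chainLen j n = chainLen i (e n) := by
      induction n using Nat.strong_induction_on with
      | _ n ihn =>
        rcases n.eq_zero_or_pos with rfl | hn
        · rw [e0, h0, chainLen]
        · obtain ⟨k, rfl⟩ := Nat.exists_eq_succ_of_ne_zero hn.ne'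
          rw [hjp.chainLen_eq hn, hi.1.chainLen_eq (epos hn), ihn _ (hjlt k), (hj hn).2]
    refine ih (i := j) ⟨hjp, fun n => (hj n.succ_pos).1⟩ (fun n => ?_) (fun n => a (e n)) ?_
    · rw [hchain]
      refine Nat.le_of_lt_succ (lt_of_le_of_ne (hd (e n)) fun hc => ?_)
      rcases n.eq_zero_or_pos with rfl | hn
      · rw [e0, h0] at hc
        omega
      · exact eend (j n) _ ⟨e n, epos hn, (hj hn).2.symm, rfl, hc⟩
    · intro m hm
      rw [(hj hm).2]
      exact (hpath m).2.1.trans_lt (ha _ (epos hm))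

namespace OIS

theorem le.trans {u v w : OIS} (h : u.le v) (h' : v.le w) : u.le w := by
  refine ⟨h.1.trans h'.1, fun k hk => (h.2.1 k hk).trans (h'.2.1 k (hk.trans_le h.1)), ?_⟩
  refine le_trans ?_ h.2.2
  rcases h.1.lt_or_eq with hlt | heq
  · unfold ordAt
    rw [if_pos hlt, if_pos (hlt.trans_le h'.1), h'.2.1 _ hlt]
  · have := h'.2.2
    rw [← heq] at this
    simpa [ordAt, heq] using this

theorem prec.last_lt {u v : OIS} (h : u.prec v) (hl : v.pairs.length = u.pairs.length) :
    v.last < u.last := by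
  obtain ⟨⟨_, hp, ho⟩, hne⟩ := h
  have ho' : v.last ≤ u.last := by simpa [ordAt, hl] using ho
  refine lt_of_le_of_ne ho' fun heq => hne ?_
  have hpairs : u.pairs = v.pairs := by
    refine List.ext_getElem hl.symm fun k h₁ h₂ => ?_
    simpa [List.getD_eq_getElem, h₁, h₂] using hp k h₁
  cases u
  cases v
  simp_all

/-- The lengths along an infinite strictly increasing chain are unbounded. -/
theorem exists_length_gt {f : ℕ → OIS} (hf : ∀ n, (f n).prec (f (n + 1))) (K : ℕ) :
    ∃ n, K < (f n).pairs.length := by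
  by_contra! hK
  have hmono : Monotone fun n => (f n).pairs.length :=
    monotone_nat_of_le_succ fun n => (hf n).1.1
  obtain ⟨N, hN⟩ : ∃ N, ∀ n, (f n).pairs.length ≤ (f N).pairs.length := by
    have hfin : (Set.range fun n => (f n).pairs.length).Finite :=
      (Set.finite_Iic K).subset (Set.range_subset_iff.2 hK)
    obtain ⟨_, ⟨N, rfl⟩, hN⟩ := Set.exists_max_image _ id hfin (Set.range_nonempty _)
    exact ⟨N, fun n => hN _ ⟨n, rfl⟩⟩
  have hlen (n : ℕ) : (f (N + n)).pairs.length = (f N).pairs.length :=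
    (hN _).antisymm (hmono (Nat.le_add_right N n))
  have hlt (n : ℕ) : (f (N + (n + 1))).last < (f (N + n)).last :=
    (hf (N + n)).last_lt ((hlen (n + 1)).trans (hlen n).symm)
  exact (RelEmbedding.natGT (r := (· < ·)) (fun n => (f (N + n)).last) hlt).not_wellFounded
    wellFounded_lt

/-- An infinite strictly increasing chain has an infinite limit sequence. -/
theorem exists_limit {f : ℕ → OIS} (hf : ∀ n, (f n).prec (f (n + 1))) :
    ∃ (i : ℕ → ℕ) (a : ℕ → Ordinal.{0}), ∀ M, ∃ n, M < (f n).pairs.length ∧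
      ∀ k ≤ M, (f n).ptrAt k = i k ∧ (f n).ordAt k = a k := by
  have hle {m n : ℕ} (h : m ≤ n) : (f m).le (f n) := by
    induction n, h using Nat.le_induction with
    | base => exact ⟨le_rfl, fun _ _ => rfl, by simp [ordAt]⟩
    | succ n _ ih => exact ih.trans (hf n).1
  have hagree {m n k : ℕ} (hm : k < (f m).pairs.length) (hn : k < (f n).pairs.length) :
      (f m).pairs.getD k (0, 0) = (f n).pairs.getD k (0, 0) := by
    rcases le_total m n with h | h
    · exact (hle h).2.1 k hm
    · exact ((hle h).2.1 k hn).symm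
  choose N hN using exists_length_gt hf
  refine ⟨fun k => ((f (N k)).pairs.getD k (0, 0)).2, fun k => ((f (N k)).pairs.getD k (0, 0)).1,
    fun M => ⟨N M, hN M, fun k hk => ?_⟩⟩
  have hk' := hk.trans_lt (hN M)
  unfold ptrAt ordAt
  rw [if_pos hk', hagree hk' (hN k)]
  exact ⟨rfl, rfl⟩

end OIS

/-- For every `ν`, there is no infinite `≺`-increasing sequence of ordinal
interaction sequences of depth at most `ν`. -/
theorem no_infinite_prec_chain (ν : ℕ) :
    ¬ ∃ f : ℕ → OIS,
        (∀ n, (f n).valid ∧ (f n).depthLE ν) ∧ ∀ n, OIS.prec (f n) (f (n + 1)) := by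
  rintro ⟨f, hf, hprec⟩
  obtain ⟨i, a, hlim⟩ := OIS.exists_limit hprec
  refine IsInteractionSeq.no_labelling ν (i := i) ⟨⟨?_, fun n => ?_⟩, fun n => ?_⟩
    (fun n => ?_) a fun m hm => ?_
  · obtain ⟨n, hn, h⟩ := hlim 0
    rw [← (h 0 le_rfl).1]
    exact (hf n).1.1.1.1 hn
  · obtain ⟨u, hu, h⟩ := hlim (n + 1)
    rw [← (h _ le_rfl).1]
    exact (hf u).1.1.1.2 n hu
  · obtain ⟨u, hu, h⟩ := hlim (n + 1)
    rw [← (h _ le_rfl).1, ← Vset_congr (n + 1) fun k hk => (h k hk.le).1]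
    exact (hf u).1.1.2 n hu
  · obtain ⟨u, hu, h⟩ := hlim n
    rw [← chainLen_congr n fun k hk => (h k hk).1]
    exact (hf u).2 n hu
  · obtain ⟨u, hu, h⟩ := hlim (m + 1)
    obtain ⟨k, rfl⟩ := Nat.exists_eq_succ_of_ne_zero hm.ne'
    have hlt : (f u).ptrAt (k + 1) < k + 1 := (hf u).1.1.1.2 k (by omega)
    have hptr := (h (k + 1) (by omega)).1
    rw [← (h _ le_rfl).2, ← hptr, ← (h _ (by omega)).2]
    exact (hf u).1.2 (k + 1) hm hu.le
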